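/- arXiv:0803.2797 — 3 statements merged into one kernel-verified Lean document; each statement's English description precedes it below -/
import Mathlib

section
/- Let n ≥ 1 and let U be the (n+1)×(n+1) complex matrix with entries U_{k,k+1} = 1 for 1 ≤ k ≤ n and all other entries 0 (the nilpotent Jordan block). For i ∈ ℕ and j ∈ ℤ let Ψ_{i,j} : ℂ^{n+1} → ℂ be the polynomial function given by the coefficient of μ^j in (x_0 + x_1μ + ⋯ + x_nμ^n)^i, with Ψ_{i,j} := 0 for j < 0. Suppose h, g : Ω → ℂ are complex-analytic on an open set Ω ⊆ ℂ^{n+1} containing 0 and satisfy ∇h(x) = U·∇g(x) for all x ∈ Ω. Then there exist complex constants b_{i,k} (i ∈ ℕ, 0 ≤ k ≤ n) and an open neighborhood Ω' ⊆ Ω of 0 such that for every x ∈ Ω' the double series Σ_{i=0}^∞ Σ_{k=0}^n b_{i,k}·Ψ_{i,n−k}(x) and Σ_{i=0}^∞ Σ_{k=0}^n b_{i,k}·Ψ_{i,n−1−k}(x) converge absolutely, and g(x) = Σ_{i=0}^∞ Σ_{k=0}^n b_{i,k}·Ψ_{i,n−k}(x) while h(x) = Σ_{i=0}^∞ Σ_{k=0}^n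 b_{i,k}·Ψ_{i,n−1−k}(x). -/
open Polynomial

/-- The gradient of `f : ℂ^d → ℂ` at `x`: the vector of complex partial derivatives. -/
noncomputable def gradC {d : ℕ} (f : (Fin d → ℂ) → ℂ) (x : Fin d → ℂ) : Fin d → ℂ :=
  fun i => fderiv ℂ f x (Pi.single i 1)

/-- `Psi n i j x` is the coefficient of `μ^j` in `(x_0 + x_1 μ + ⋯ + x_n μ^n)^i`,
with the convention `Psi n i j = 0` for `j < 0`. -/
noncomputable def Psi (n : ℕ) (i : ℕ) (j : ℤ) (x : Fin (n + 1) → ℂ) : ℂ :=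
  if j < 0 then 0
  else ((∑ k : Fin (n + 1), C (x k) * X ^ (k : ℕ)) ^ i).coeff j.toNat

noncomputable def ev (n k : ℕ) : Fin (n + 1) → ℂ := fun j => if (j : ℕ) = k then 1 else 0

noncomputable def DD (n k : ℕ) (f : (Fin (n + 1) → ℂ) → ℂ) (x : Fin (n + 1) → ℂ) : ℂ :=
  fderiv ℂ f x (ev n k)

noncomputable def PP (n : ℕ) (x : Fin (n + 1) → ℂ) : ℂ[X] :=
  ∑ k : Fin (n + 1), C (x k) * X ^ (k : ℕ)

lemma ev_single (n : ℕ) (k : Fin (n + 1)) : ev n k = Pi.single k 1 := by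
  funext j
  simp [ev, Pi.single_apply, Fin.ext_iff]

lemma ev_zero (n k : ℕ) (hk : n < k) : ev n k = 0 := by
  funext j
  have := j.2
  simp [ev]
  omega

lemma DD_zero (n k : ℕ) (hk : n < k) (f : (Fin (n + 1) → ℂ) → ℂ) : DD n k f = fun _ => 0 := by
  funext x
  simp [DD, ev_zero n k hk]

lemma fderiv_eq_sum (n : ℕ) (f : (Fin (n + 1) → ℂ) → ℂ) (y x : Fin (n + 1) → ℂ) :
    fderiv ℂ f y x = ∑ k : Fin (n + 1), x k * DD n k f y := by
  have hx : x = ∑ k : Fin (n + 1), x k • ev n k := by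
    simp_rw [ev_single]
    funext j
    simp [Finset.sum_apply, Pi.single_apply]
  conv_lhs => rw [hx]
  simp [map_sum, DD]

lemma DD_analytic {n k : ℕ} {f : (Fin (n + 1) → ℂ) → ℂ} {Ω : Set (Fin (n + 1) → ℂ)}
    (hf : ∀ x ∈ Ω, AnalyticAt ℂ f x) : ∀ x ∈ Ω, AnalyticAt ℂ (DD n k f) x := by
  intro x hx
  have := (hf x hx).fderiv
  exact (ContinuousLinearMap.apply ℂ ℂ (ev n k)).analyticAt _ |>.comp this

lemma DD_congr {n k : ℕ} {f g : (Fin (n + 1) → ℂ) → ℂ} {Ω : Set (Fin (n + 1) → ℂ)}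
    (hΩ : IsOpen Ω) (hfg : ∀ x ∈ Ω, f x = g x) : ∀ x ∈ Ω, DD n k f x = DD n k g x := by
  intro x hx
  have : f =ᶠ[nhds x] g := Filter.eventually_of_mem (hΩ.mem_nhds hx) hfg
  simp only [DD, this.fderiv_eq]

lemma DD_comm {n : ℕ} (j k : ℕ) {f : (Fin (n + 1) → ℂ) → ℂ} {x : Fin (n + 1) → ℂ}
    (hf : AnalyticAt ℂ f x) : DD n j (DD n k f) x = DD n k (DD n j f) x := by
  have hd : DifferentiableAt ℂ (fderiv ℂ f) x := hf.fderiv.differentiableAt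
  have key : ∀ a b : ℕ, DD n a (DD n b f) x = fderiv ℂ (fderiv ℂ f) x (ev n a) (ev n b) := by
    intro a b
    have h1 : DD n b f = fun y => fderiv ℂ f y (ev n b) := rfl
    rw [h1, DD, fderiv_clm_apply hd (by fun_prop)]
    simp
  rw [key, key]
  exact (hf.contDiffAt (n := 2)).isSymmSndFDerivAt (by simp) _ _

lemma iter_analytic {n : ℕ} {f : (Fin (n + 1) → ℂ) → ℂ} {Ω : Set (Fin (n + 1) → ℂ)}
    (hf : ∀ x ∈ Ω, AnalyticAt ℂ f x) (m : ℕ) :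
    ∀ x ∈ Ω, AnalyticAt ℂ ((DD n 0)^[m] f) x := by
  induction m with
  | zero => exact hf
  | succ m ih =>
    rw [Function.iterate_succ_apply']
    exact DD_analytic ih

lemma iter_zero (n m : ℕ) : (DD n 0)^[m] (fun _ => 0) = fun _ => 0 := by
  induction m with
  | zero => rfl
  | succ m ih =>
    rw [Function.iterate_succ_apply', ih]
    funext x
    simp [DD]

lemma iter_hankel {n : ℕ} {A : ℕ → (Fin (n + 1) → ℂ) → ℂ} {Ω : Set (Fin (n + 1) → ℂ)}
    (hΩ : IsOpen Ω) (hA : ∀ w, ∀ x ∈ Ω, AnalyticAt ℂ (A w) x)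
    (hH : ∀ k w, ∀ x ∈ Ω, DD n k (A w) x = DD n 0 (A (w + k)) x) (m : ℕ) :
    ∀ k w, ∀ x ∈ Ω, DD n k ((DD n 0)^[m] (A w)) x = (DD n 0)^[m + 1] (A (w + k)) x := by
  induction m with
  | zero => exact hH
  | succ m ih =>
    intro k w x hx
    rw [Function.iterate_succ_apply', DD_comm _ _ (iter_analytic (hA w) m x hx),
      Function.iterate_succ_apply' _ (m + 1)]
    exact DD_congr hΩ (ih k w) x hx

lemma coeff_succ (n i j : ℕ) (x : Fin (n + 1) → ℂ) :
    (PP n x ^ (i + 1)).coeff j =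
      ∑ k : Fin (n + 1), x k * (if (k : ℕ) ≤ j then (PP n x ^ i).coeff (j - k) else 0) := by
  rw [pow_succ]
  conv_lhs => rw [PP, Finset.mul_sum, finset_sum_coeff]
  refine Finset.sum_congr rfl fun k _ => ?_
  rw [mul_left_comm, coeff_C_mul, coeff_mul_X_pow']
  rfl

lemma coeff_bound (n i : ℕ) (x : Fin (n + 1) → ℂ) :
    ∀ j, ‖(PP n x ^ i).coeff j‖ ≤ (∑ k, ‖x k‖) ^ i := by
  induction i with
  | zero =>
    intro j
    simp only [pow_zero, coeff_one]
    split_ifs <;> simp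
  | succ i ih =>
    intro j
    rw [coeff_succ, pow_succ', Finset.sum_mul]
    refine (norm_sum_le _ _).trans (Finset.sum_le_sum fun k _ => ?_)
    rw [norm_mul]
    refine mul_le_mul_of_nonneg_left ?_ (norm_nonneg _)
    split_ifs
    · exact ih _
    · simp; positivity

lemma shift_sum (n k : ℕ) (q B : ℕ → ℂ) (hB : ∀ v, n < v → B v = 0) :
    ∑ v ∈ Finset.range (n + 1), (if k ≤ v then q (v - k) else 0) * B v =
      ∑ w ∈ Finset.range (n + 1), q w * B (w + k) := by
  have h1 : ∑ v ∈ Finset.range (n + 1), (if k ≤ v then q (v - k) else 0) * B v =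
      ∑ v ∈ Finset.range (k + (n + 1)), (if k ≤ v then q (v - k) else 0) * B v := by
    refine Finset.sum_subset (by intro a; simp; omega) ?_
    intro v _ hv
    rw [hB v (by simpa using hv), mul_zero]
  rw [h1, Finset.sum_range_add]
  rw [Finset.sum_eq_zero, zero_add]
  · refine Finset.sum_congr rfl fun w _ => ?_
    simp [add_comm]
  · intro v hv
    have := Finset.mem_range.1 hv
    rw [if_neg (by omega), zero_mul]

lemma deriv_line {n : ℕ} {f : (Fin (n + 1) → ℂ) → ℂ} (x : Fin (n + 1) → ℂ) (t : ℂ)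
    (hf : AnalyticAt ℂ f (t • x)) :
    HasDerivAt (fun s : ℂ => f (s • x)) (∑ k : Fin (n + 1), x k * DD n k f (t • x)) t := by
  rw [← fderiv_eq_sum]
  have h1 : HasDerivAt (fun s : ℂ => s • x) x t := by
    simpa using (hasDerivAt_id t).smul_const x
  exact (hf.differentiableAt.hasFDerivAt).comp_hasDerivAt t h1

lemma iter_line {n : ℕ} {f : (Fin (n + 1) → ℂ) → ℂ} {A : ℕ → (Fin (n + 1) → ℂ) → ℂ}
    {Ω : Set (Fin (n + 1) → ℂ)}
    (hΩ : IsOpen Ω) (hf : ∀ x ∈ Ω, AnalyticAt ℂ f x)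
    (hA : ∀ w, ∀ x ∈ Ω, AnalyticAt ℂ (A w) x)
    (hA0 : ∀ w, n < w → A w = fun _ => 0)
    (hfA : ∀ k, ∀ x ∈ Ω, DD n k f x = A k x)
    (hH : ∀ k w, ∀ x ∈ Ω, DD n k (A w) x = DD n 0 (A (w + k)) x)
    (x : Fin (n + 1) → ℂ) (d : ℕ) :
    ∀ t : ℂ, t • x ∈ Ω → iteratedDeriv (d + 1) (fun s : ℂ => f (s • x)) t =
      ∑ w ∈ Finset.range (n + 1), (PP n x ^ (d + 1)).coeff w * (DD n 0)^[d] (A w) (t • x) := by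
  have hopen : IsOpen {t : ℂ | t • x ∈ Ω} := hΩ.preimage (by fun_prop)
  induction d with
  | zero =>
    intro t ht
    rw [iteratedDeriv_one, (deriv_line x t (hf _ ht)).deriv]
    simp only [zero_add, coeff_succ, pow_zero, Finset.sum_mul, mul_assoc]
    rw [Finset.sum_comm]
    refine Finset.sum_congr rfl fun k _ => ?_
    rw [← Finset.mul_sum, shift_sum n k _ (fun w => (DD n 0)^[0] (A w) (t • x))]
    · simp only [coeff_one]
      rw [Finset.sum_eq_single 0]
      · simp [hfA _ _ ht]
      · intro b _ hb
        simp [hb]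
      · simp
    · intro v hv
      simp [hA0 v hv]
  | succ d ih =>
    intro t ht
    rw [iteratedDeriv_succ]
    have he : iteratedDeriv (d + 1) (fun s : ℂ => f (s • x)) =ᶠ[nhds t] fun t =>
      ∑ w ∈ Finset.range (n + 1), (PP n x ^ (d + 1)).coeff w * (DD n 0)^[d] (A w) (t • x) :=
      Filter.eventually_of_mem (hopen.mem_nhds ht) ih
    rw [he.deriv_eq]
    have hd : HasDerivAt (fun t : ℂ =>
      ∑ w ∈ Finset.range (n + 1), (PP n x ^ (d + 1)).coeff w * (DD n 0)^[d] (A w) (t • x))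
      (∑ w ∈ Finset.range (n + 1), (PP n x ^ (d + 1)).coeff w *
        (∑ k : Fin (n + 1), x k * DD n k ((DD n 0)^[d] (A w)) (t • x))) t := by
      refine HasDerivAt.fun_sum fun w _ => ?_
      exact (deriv_line x t (iter_analytic (hA w) d _ ht)).const_mul _
    rw [hd.deriv]
    simp only [coeff_succ n (d + 1), Finset.sum_mul, mul_assoc, Finset.mul_sum]
    rw [Finset.sum_comm, Finset.sum_comm (s := Finset.range (n + 1))]
    refine Finset.sum_congr rfl fun k _ => ?_
    rw [← Finset.mul_sum, shift_sum n k _ (fun w => (DD n 0)^[d + 1] (A w) (t • x))]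
    · rw [Finset.mul_sum]
      refine Finset.sum_congr rfl fun w _ => ?_
      rw [iter_hankel hΩ hA hH d k w _ ht]
      ring
    · intro v hv
      simp only [hA0 v hv, iter_zero]

/-- Taylor expansion along the ray through `x`. -/
lemma taylor_line {n : ℕ} {f : (Fin (n + 1) → ℂ) → ℂ} {R : ℝ}
    (hf : ∀ x ∈ Metric.ball (0 : Fin (n + 1) → ℂ) R, AnalyticAt ℂ f x)
    (x : Fin (n + 1) → ℂ) (c : ℝ) (hc : 0 < c) (hx : c * ‖x‖ < R) (t : ℂ) (ht : ‖t‖ < c) :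
    HasSum (fun i : ℕ => ((i.factorial : ℂ))⁻¹ * t ^ i *
      iteratedDeriv i (fun s : ℂ => f (s • x)) 0) (f (t • x)) := by
  have hd : DifferentiableOn ℂ (fun s : ℂ => f (s • x)) (Metric.ball 0 c) := by
    intro s hs
    refine (deriv_line x s (hf _ ?_)).differentiableAt.differentiableWithinAt
    rw [mem_ball_zero_iff] at hs ⊢
    rw [norm_smul]
    exact (mul_le_mul_of_nonneg_right hs.le (norm_nonneg x)).trans_lt hx
  have := Complex.hasSum_taylorSeries_on_ball hd (z := t) (by simpa using ht)
  simpa [mul_assoc] using this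

lemma iter_e0 {n : ℕ} {f : (Fin (n + 1) → ℂ) → ℂ} {Ω : Set (Fin (n + 1) → ℂ)}
    (hΩ : IsOpen Ω) (hf : ∀ x ∈ Ω, AnalyticAt ℂ f x) (d : ℕ) :
    ∀ t : ℂ, t • ev n 0 ∈ Ω →
      iteratedDeriv d (fun s : ℂ => f (s • ev n 0)) t = (DD n 0)^[d] f (t • ev n 0) := by
  have hopen : IsOpen {t : ℂ | t • ev n 0 ∈ Ω} := hΩ.preimage (by fun_prop)
  induction d with
  | zero => intro t _; simp
  | succ d ih =>
    intro t ht
    have he : iteratedDeriv d (fun s : ℂ => f (s • ev n 0)) =ᶠ[nhds t] fun t =>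
      (DD n 0)^[d] f (t • ev n 0) := Filter.eventually_of_mem (hopen.mem_nhds ht) ih
    rw [iteratedDeriv_succ, he.deriv_eq, (deriv_line _ t (iter_analytic hf d _ ht)).deriv,
      ← fderiv_eq_sum, Function.iterate_succ_apply', DD]

lemma coeff_decay {n : ℕ} {f : (Fin (n + 1) → ℂ) → ℂ} {R r : ℝ} (hr : 0 < r) (hrR : r < R)
    (hf : ∀ x ∈ Metric.ball (0 : Fin (n + 1) → ℂ) R, AnalyticAt ℂ f x) :
    ∃ M : ℝ, ∀ d : ℕ, ‖(DD n 0)^[d] f 0‖ / d.factorial * r ^ d ≤ M := by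
  have hnorm : ‖ev n 0‖ ≤ 1 := by
    rw [pi_norm_le_iff_of_nonneg zero_le_one]
    intro i
    simp only [ev]
    split_ifs <;> simp
  obtain ⟨c, hc1, hc2⟩ := exists_between hrR
  have hs := taylor_line hf (ev n 0) c (hr.trans hc1) (by nlinarith) (r : ℂ)
    (by rw [Complex.norm_real, Real.norm_of_nonneg hr.le]; exact hc1)
  have hb := hs.summable.tendsto_atTop_zero.norm.bddAbove_range
  obtain ⟨M, hM⟩ := hb
  refine ⟨M, fun d => ?_⟩
  have := hM ⟨d, rfl⟩
  have he := iter_e0 Metric.isOpen_ball hf d 0 (by simpa using hr.trans hrR)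
  rw [zero_smul] at he
  simp only [he] at this
  refine le_trans (le_of_eq ?_) this
  simp [abs_of_pos hr]
  ring

lemma Psi_neg (n i : ℕ) (j : ℤ) (x : Fin (n + 1) → ℂ) (hj : j < 0) : Psi n i j x = 0 := by
  simp [Psi, hj]

lemma Psi_nat (n i j : ℕ) (x : Fin (n + 1) → ℂ) : Psi n i (j : ℤ) x = (PP n x ^ i).coeff j := by
  simp [Psi, PP]

lemma Psi_bound (n i : ℕ) (j : ℤ) (x : Fin (n + 1) → ℂ) :
    ‖Psi n i j x‖ ≤ (∑ k, ‖x k‖) ^ i := by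
  rcases lt_or_ge j 0 with hj | hj
  · rw [Psi_neg n i j x hj]; simp; positivity
  · lift j to ℕ using hj
    rw [Psi_nat]
    exact coeff_bound n i x j

noncomputable def bb (n : ℕ) (h g : (Fin (n + 1) → ℂ) → ℂ) (i k : ℕ) : ℂ :=
  match i with
  | 0 => if k = n then g 0 else if k + 1 = n then h 0 else 0
  | d + 1 => ((d + 1).factorial : ℂ)⁻¹ * (DD n 0)^[d] (DD n (n - k) g) 0

lemma bb_bound {n : ℕ} {h g : (Fin (n + 1) → ℂ) → ℂ} {R r : ℝ} (hr : 0 < r) (hrR : r < R)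
    (hg : ∀ x ∈ Metric.ball (0 : Fin (n + 1) → ℂ) R, AnalyticAt ℂ g x) :
    ∃ M : ℝ, 0 ≤ M ∧ ∀ i k, k ≤ n → ‖bb n h g i k‖ * r ^ i ≤ M := by
  have := fun w : ℕ => coeff_decay hr hrR (DD_analytic (k := w) hg)
  choose M hM using this
  have hM0 : ∀ w, 0 ≤ M w := fun w => le_trans (by positivity) (hM w 0)
  have hS : 0 ≤ ∑ w ∈ Finset.range (n + 1), M w := Finset.sum_nonneg fun w _ => hM0 w
  refine ⟨‖g 0‖ + ‖h 0‖ + r * ∑ w ∈ Finset.range (n + 1), M w, by positivity, ?_⟩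
  intro i k hk
  rcases i with _ | d
  · have : 0 ≤ r * ∑ w ∈ Finset.range (n + 1), M w := by positivity
    have h1 := norm_nonneg (g 0)
    have h2 := norm_nonneg (h 0)
    simp only [bb, pow_zero, mul_one]
    split_ifs
    · linarith
    · linarith
    · simp; linarith
  · have h3 := hM (n - k) d
    have h4 : M (n - k) ≤ ∑ w ∈ Finset.range (n + 1), M w :=
      Finset.single_le_sum (f := M) (fun w _ => hM0 w) (by simp)
    have h5 : ‖bb n h g (d + 1) k‖ ≤ ‖(DD n 0)^[d] (DD n (n - k) g) 0‖ / d.factorial := by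
      simp only [bb, norm_mul, norm_inv, Complex.norm_natCast]
      rw [inv_mul_eq_div]
      gcongr
      omega
    calc ‖bb n h g (d + 1) k‖ * r ^ (d + 1) = r * (‖bb n h g (d + 1) k‖ * r ^ d) := by ring
      _ ≤ r * (‖(DD n 0)^[d] (DD n (n - k) g) 0‖ / d.factorial * r ^ d) := by gcongr
      _ ≤ r * ∑ w ∈ Finset.range (n + 1), M w := by gcongr; exact h3.trans h4
      _ ≤ _ := by
        have h1 := norm_nonneg (g 0)
        have h2 := norm_nonneg (h 0)
        linarith

lemma summ {n : ℕ} (b : ℕ → ℕ → ℂ) {r M : ℝ} (hr : 0 < r) (hM0 : 0 ≤ M)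
    (hb : ∀ i k, k ≤ n → ‖b i k‖ * r ^ i ≤ M) (x : Fin (n + 1) → ℂ) (hx : ∑ k, ‖x k‖ < r)
    (J : ℕ → ℤ) :
    Summable (fun p : ℕ × Fin (n + 1) => ‖b p.1 (p.2 : ℕ) * Psi n p.1 (J p.2) x‖) := by
  have hS : 0 ≤ ∑ k, ‖x k‖ := by positivity
  have h1 : Summable fun i : ℕ => M * ((∑ k, ‖x k‖) / r) ^ i :=
    (summable_geometric_of_lt_one (by positivity) ((div_lt_one hr).2 hx)).mul_left M
  have h2 : Summable fun _ : Fin (n + 1) => (1 : ℝ) := Summable.of_finite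
  have h3 := h1.mul_of_nonneg h2 (fun i => by positivity) (fun _ => zero_le_one)
  refine Summable.of_nonneg_of_le (fun _ => norm_nonneg _) ?_ h3
  rintro ⟨i, k⟩
  simp only [norm_mul, mul_one]
  calc ‖b i k‖ * ‖Psi n i (J k) x‖ ≤ ‖b i k‖ * (∑ k, ‖x k‖) ^ i := by
        gcongr; exact Psi_bound _ _ _ _
    _ = (‖b i k‖ * r ^ i) * ((∑ k, ‖x k‖) / r) ^ i := by
        rw [div_pow]; field_simp
    _ ≤ _ := by
        gcongr
        exact hb i k (by omega)

/-- Every analytic solution of `∇h = U∇g`, `U` the nilpotent Jordan block of size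
`n+1`, is near `0` a *-power series of the simple solution
`x_μ = x_0 + x_1 μ + ⋯ + x_n μ^n`: there are constants `b_{i,k}` such that the double
series `Σ_i Σ_{k=0}^n b_{i,k} Ψ_{i,n−k}` and `Σ_i Σ_{k=0}^n b_{i,k} Ψ_{i,n−1−k}`
converge absolutely to `g` and `h` respectively on a neighborhood of `0`. -/
theorem stmt_0 (n : ℕ) (hn : 1 ≤ n)
    (U : Matrix (Fin (n + 1)) (Fin (n + 1)) ℂ)
    (hU : U = Matrix.of fun a b : Fin (n + 1) => if (b : ℕ) = (a : ℕ) + 1 then (1 : ℂ) else 0)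
    (Ω : Set (Fin (n + 1) → ℂ)) (hΩ : IsOpen Ω) (h0 : (0 : Fin (n + 1) → ℂ) ∈ Ω)
    (h g : (Fin (n + 1) → ℂ) → ℂ)
    (hh : ∀ x ∈ Ω, AnalyticAt ℂ h x) (hg : ∀ x ∈ Ω, AnalyticAt ℂ g x)
    (heq : ∀ x ∈ Ω, gradC h x = U.mulVec (gradC g x)) :
    ∃ (b : ℕ → ℕ → ℂ) (Ω' : Set (Fin (n + 1) → ℂ)),
      Ω' ⊆ Ω ∧ IsOpen Ω' ∧ (0 : Fin (n + 1) → ℂ) ∈ Ω' ∧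
      ∀ x ∈ Ω',
        Summable (fun p : ℕ × Fin (n + 1) =>
          ‖b p.1 (p.2 : ℕ) * Psi n p.1 ((n : ℤ) - ((p.2 : ℕ) : ℤ)) x‖) ∧
        Summable (fun p : ℕ × Fin (n + 1) =>
          ‖b p.1 (p.2 : ℕ) * Psi n p.1 ((n : ℤ) - 1 - ((p.2 : ℕ) : ℤ)) x‖) ∧
        g x = ∑' i : ℕ, ∑ k ∈ Finset.range (n + 1), b i k * Psi n i ((n : ℤ) - (k : ℤ)) x ∧
        h x = ∑' i : ℕ, ∑ k ∈ Finset.range (n + 1), b i k * Psi n i ((n : ℤ) - 1 - (k : ℤ)) x := by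
  have hU' : ∀ k, ∀ x ∈ Ω, DD n k h x = DD n (k + 1) g x := by
    intro k x hx
    rcases lt_or_ge n k with hk | hk
    · rw [DD_zero n k hk, DD_zero n (k + 1) (by omega)]
    · have h1 := congrFun (heq x hx) ⟨k, by omega⟩
      have h2 : gradC h x ⟨k, by omega⟩ = DD n k h x := by
        rw [gradC, DD, ← ev_single]
      rw [h2, hU] at h1
      rw [h1]
      simp only [Matrix.mulVec, dotProduct, Matrix.of_apply, ite_mul, one_mul, zero_mul]
      rcases Nat.lt_or_ge k n with hkn | hkn
      · rw [Finset.sum_eq_single ⟨k + 1, by omega⟩]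
        · rw [if_pos rfl, gradC, DD, ← ev_single]
        · intro b _ hb
          rw [if_neg]
          intro hbk
          exact hb (Fin.ext hbk)
        · simp
      · rw [DD_zero n (k + 1) (by omega)]
        refine Finset.sum_eq_zero fun b _ => ?_
        rw [if_neg]
        have := b.2
        omega
  have hsw : ∀ k w, ∀ x ∈ Ω, DD n k (DD n (w + 1) g) x = DD n (k + 1) (DD n w g) x := by
    intro k w x hx
    rw [← DD_congr hΩ (hU' w) x hx, DD_comm _ _ (hh x hx), DD_congr hΩ (hU' k) x hx,
      DD_comm _ _ (hg x hx)]
  have hH : ∀ k w, ∀ x ∈ Ω, DD n k (DD n w g) x = DD n 0 (DD n (w + k) g) x := by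
    intro k
    induction k with
    | zero => intro w x _; rfl
    | succ k ih =>
      intro w x hx
      rw [← hsw k w x hx, ih (w + 1) x hx]
      congr 2
      omega
  obtain ⟨R, hR, hball⟩ := Metric.isOpen_iff.1 hΩ 0 h0
  have hgB : ∀ x ∈ Metric.ball (0 : Fin (n + 1) → ℂ) R, AnalyticAt ℂ g x :=
    fun x hx => hg x (hball hx)
  have hhB : ∀ x ∈ Metric.ball (0 : Fin (n + 1) → ℂ) R, AnalyticAt ℂ h x :=
    fun x hx => hh x (hball hx)
  have hr : 0 < R / 2 := by positivity
  obtain ⟨M, hM0, hM⟩ := bb_bound (h := h) hr (by linarith) hgB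
  have hle : ∀ x : Fin (n + 1) → ℂ, ‖x‖ ≤ ∑ k, ‖x k‖ := by
    intro x
    rw [pi_norm_le_iff_of_nonneg (by positivity)]
    intro i
    exact Finset.single_le_sum (f := fun k => ‖x k‖) (fun k _ => norm_nonneg _)
      (Finset.mem_univ i)
  refine ⟨bb n h g, {x | ∑ k, ‖x k‖ < R / 2}, ?_, ?_, ?_, ?_⟩
  · intro x hx
    apply hball
    rw [mem_ball_zero_iff]
    have := hle x
    simp only [Set.mem_setOf_eq] at hx
    linarith
  · exact isOpen_lt (by fun_prop) continuous_const
  · simp [hR]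
  intro x hx
  simp only [Set.mem_setOf_eq] at hx
  have hxn : 2 * ‖x‖ < R := by linarith [hle x]
  refine ⟨summ _ hr hM0 hM x hx (fun k => (n : ℤ) - (k : ℤ)),
    summ _ hr hM0 hM x hx (fun k => (n : ℤ) - 1 - (k : ℤ)), ?_, ?_⟩
  · have hT := taylor_line hgB x 2 (by norm_num) hxn 1 (by simp)
    rw [one_smul] at hT
    rw [← hT.tsum_eq]
    refine tsum_congr fun i => ?_
    rw [← Finset.sum_range_reflect]
    have hps : ∀ w ∈ Finset.range (n + 1),
        bb n h g i (n + 1 - 1 - w) * Psi n i ((n : ℤ) - ((n + 1 - 1 - w : ℕ) : ℤ)) x =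
        bb n h g i (n - w) * (PP n x ^ i).coeff w := by
      intro w hw
      have := Finset.mem_range.1 hw
      rw [← Psi_nat]
      congr 2
      omega
    rw [Finset.sum_congr rfl hps]
    rcases i with _ | d
    · rw [Finset.sum_eq_single 0]
      · simp [bb]
      · intro w _ hw
        simp [coeff_one, hw]
      · simp
    · rw [iter_line hΩ hg (fun w => DD_analytic hg) (fun w hw => DD_zero n w hw g)
        (fun k x _ => rfl) hH x d 0 (by simpa using h0), Finset.mul_sum]
      refine Finset.sum_congr rfl fun w hw => ?_
      have := Finset.mem_range.1 hw
      simp only [bb, zero_smul]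
      rw [show n - (n - w) = w by omega]
      ring
  · have hT := taylor_line hhB x 2 (by norm_num) hxn 1 (by simp)
    rw [one_smul] at hT
    rw [← hT.tsum_eq]
    refine tsum_congr fun i => ?_
    rw [Finset.sum_range_succ, Psi_neg n i ((n : ℤ) - 1 - (n : ℤ)) x (by omega), mul_zero,
      add_zero, ← Finset.sum_range_reflect]
    have hps : ∀ w ∈ Finset.range n,
        bb n h g i (n - 1 - w) * Psi n i ((n : ℤ) - 1 - ((n - 1 - w : ℕ) : ℤ)) x =
        bb n h g i (n - 1 - w) * (PP n x ^ i).coeff w := by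
      intro w hw
      have := Finset.mem_range.1 hw
      rw [← Psi_nat]
      congr 2
      omega
    rw [Finset.sum_congr rfl hps]
    rcases i with _ | d
    · rw [Finset.sum_eq_single 0]
      · have h1 : n - 1 ≠ n := by omega
        have h2 : n - 1 + 1 = n := by omega
        simp [bb, h1, h2]
      · intro w _ hw
        simp [coeff_one, hw]
      · simp
        omega
    · rw [iter_line (A := fun w => DD n (w + 1) g) hΩ hh (fun w => DD_analytic hg)
        (fun w hw => DD_zero n (w + 1) (by omega) g)
        hU' (fun k w y hy => by rw [hH k (w + 1) y hy]; congr 2; omega) x d 0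
        (by simpa using h0), Finset.sum_range_succ, DD_zero n (n + 1) (by omega), iter_zero,
        mul_zero, add_zero, Finset.mul_sum]
      refine Finset.sum_congr rfl fun w hw => ?_
      have := Finset.mem_range.1 hw
      simp only [bb, zero_smul]
      rw [show n - (n - 1 - w) = w + 1 by omega]
      ring
end

section
/- Let n ≥ 0 and let M be a real block-diagonal matrix of total size 2(n+1), M = diag(M_1, …, M_m), where each M_t is a real Jordan block with eigenvalues ±i: M_t consists of 2×2 blocks with Λ = [[0,1],[−1,0]] on the block diagonal, the 2×2 identity on the block superdiagonal, and zero blocks elsewhere. Let Z_j denote the coefficient of μ^j in the polynomial (1+μ²)^{n+1}. Then M is invertible, and for every nonempty open convex set Ω ⊆ ℝ^{2(n+1)} and all smooth functions f, g : Ω → ℝ with ∇f = M·∇g on Ω, there exist smooth functions V_1, …, V_{2n} : Ω → ℝ such that, setting V_0 := f, V_{2n+1} := g and V_{−1} := 0, the equations M^{−1}·∇V_j + ∇V_{j−1} = Z_j·∇g hold on Ω for every j = 0, 1, …, 2n+1. Moreover the functions V_1, …, V_{2n} are unique up to additive constants: any two such tuples differ by constants in each component. -/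
open Polynomial

/-- The gradient of `f : ℝ^d → ℝ` at `x`: the vector of partial derivatives. -/
noncomputable def grad {d : ℕ} (f : (Fin d → ℝ) → ℝ) (x : Fin d → ℝ) : Fin d → ℝ :=
  fun i => fderiv ℝ f x (Pi.single i 1)

/-- A real block-diagonal matrix of total size `2(n+1)` built from real Jordan blocks
with eigenvalues `±i`: `Λ = [[0,1],[−1,0]]` on the 2×2 block diagonal, and the 2×2
identity at pair-superdiagonal position `(p, p+1)` exactly when `ε p = true` (the
pattern `ε` encodes the block decomposition `M = diag(M_1, …, M_m)`). -/
def realJordanDiag (n : ℕ) (ε : ℕ → Bool) : Matrix (Fin (2 * (n + 1))) (Fin (2 * (n + 1))) ℝ :=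
  Matrix.of fun a b =>
    if (a : ℕ) % 2 = 0 ∧ (b : ℕ) = (a : ℕ) + 1 then 1
    else if (a : ℕ) % 2 = 1 ∧ (a : ℕ) = (b : ℕ) + 1 then -1
    else if (b : ℕ) = (a : ℕ) + 2 ∧ ε ((a : ℕ) / 2) then 1 else 0


lemma jord_low (n : ℕ) (ε : ℕ → Bool) (a b : Fin (2 * (n + 1)))
    (h : (b : ℕ) / 2 < (a : ℕ) / 2) : realJordanDiag n ε a b = 0 := by
  simp only [realJordanDiag, Matrix.of_apply]
  rw [if_neg (by omega), if_neg (by omega), if_neg (by rintro ⟨h1, -⟩; omega)]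

lemma jord_sq (n : ℕ) (ε : ℕ → Bool) (a b : Fin (2 * (n + 1)))
    (h : (b : ℕ) / 2 ≤ (a : ℕ) / 2) :
    (1 + realJordanDiag n ε ^ 2 : Matrix (Fin (2 * (n + 1))) (Fin (2 * (n + 1))) ℝ) a b = 0 := by
  rw [pow_two, Matrix.add_apply, Matrix.mul_apply]
  rcases h.lt_or_eq with h | h
  · rw [Matrix.one_apply_ne (by rintro rfl; omega), zero_add]
    refine Finset.sum_eq_zero fun c _ => ?_
    by_cases hc : (c : ℕ) / 2 < (a : ℕ) / 2
    · rw [jord_low n ε a c hc, zero_mul]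
    · rw [jord_low n ε c b (by omega), mul_zero]
  · have ha := a.2
    have hb := b.2
    let c0 : Fin (2 * (n + 1)) := ⟨if (a : ℕ) % 2 = 0 then a + 1 else a - 1, by split_ifs <;> omega⟩
    have hc0 : (c0 : ℕ) = if (a : ℕ) % 2 = 0 then (a : ℕ) + 1 else a - 1 := rfl
    rw [Finset.sum_eq_single c0]
    · rw [Matrix.one_apply]
      simp only [realJordanDiag, Matrix.of_apply, hc0, Fin.ext_iff]
      rcases Nat.mod_two_eq_zero_or_one (a : ℕ) with h2 | h2 <;>
      rcases Nat.mod_two_eq_zero_or_one (b : ℕ) with h3 | h3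
      · have : (a : ℕ) = b := by omega
        have h4 : ((b : ℕ) + 1) % 2 = 1 := by omega
        simp [this, h3, h4]
      · have : (b : ℕ) = a + 1 := by omega
        have h4 : ((a : ℕ) + 1) % 2 = 1 := by omega
        simp [this, h2, h4]
      · have : (a : ℕ) = b + 1 := by omega
        have h4 : ((b : ℕ) + 1) % 2 = 1 := by omega
        simp [this, h3, h4]
      · have : (a : ℕ) = b := by omega
        have h5 : (b : ℕ) = (b - 1) + 1 := by omega
        have h4 : ((b : ℕ) - 1) % 2 = 0 := by omega
        simp [this, h3, h4, ← h5]
    · intro c _ hc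
      by_cases h1 : (c : ℕ) / 2 < (a : ℕ) / 2
      · rw [jord_low n ε a c h1, zero_mul]
      by_cases h2 : (b : ℕ) / 2 < (c : ℕ) / 2
      · rw [jord_low n ε c b h2, mul_zero]
      have h3 : c = a := by
        have : (c : ℕ) ≠ c0 := fun h => hc (Fin.ext h)
        rw [hc0] at this
        apply Fin.ext
        split_ifs at this <;> omega
      subst h3
      have : realJordanDiag n ε c c = 0 := by
        simp only [realJordanDiag, Matrix.of_apply]
        rw [if_neg (by omega), if_neg (by omega), if_neg (by rintro ⟨h1, -⟩; omega)]
      rw [this, zero_mul]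
    · simp

lemma jord_nilp (n : ℕ) (ε : ℕ → Bool) : (1 + realJordanDiag n ε ^ 2) ^ (n + 1) = 0 := by
  have key : ∀ k : ℕ, ∀ a b : Fin (2 * (n + 1)), (b : ℕ) / 2 < (a : ℕ) / 2 + k →
      ((1 + realJordanDiag n ε ^ 2) ^ k : Matrix (Fin (2 * (n + 1))) (Fin (2 * (n + 1))) ℝ) a b = 0 := by
    intro k
    induction k with
    | zero =>
      intro a b h
      rw [pow_zero, Matrix.one_apply_ne (by rintro rfl; omega)]
    | succ k ih =>
      intro a b h
      rw [pow_succ, Matrix.mul_apply]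
      refine Finset.sum_eq_zero fun c _ => ?_
      by_cases hc : (c : ℕ) / 2 < (a : ℕ) / 2 + k
      · rw [ih a c hc, zero_mul]
      · rw [jord_sq n ε c b (by omega), mul_zero]
  ext a b
  exact key _ a b (by omega)

/-- The matrices `A_j` with `∇V_j = A_j ∇g`. -/
noncomputable def seqA {d : ℕ} (M : Matrix (Fin d) (Fin d) ℝ) (Z : ℕ → ℝ) :
    ℕ → Matrix (Fin d) (Fin d) ℝ
  | 0 => M
  | j + 1 => M * (Z (j + 1) • 1 - seqA M Z j)

lemma seqA_comm {d : ℕ} (M : Matrix (Fin d) (Fin d) ℝ) (Z : ℕ → ℝ) (j : ℕ) :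
    Commute M (seqA M Z j) := by
  induction j with
  | zero => exact Commute.refl M
  | succ j ih =>
    exact (Commute.refl M).mul_right (((Commute.one_right M).smul_right _).sub_right ih)

lemma fderiv_eq_grad {d : ℕ} (f : (Fin d → ℝ) → ℝ) (x v : Fin d → ℝ) :
    fderiv ℝ f x v = grad f x ⬝ᵥ v := by
  conv_lhs => rw [← Finset.univ_sum_single v]
  rw [map_sum]
  simp only [dotProduct, grad]
  refine Finset.sum_congr rfl fun i _ => ?_
  rw [show (Pi.single i (v i) : Fin d → ℝ) = v i • Pi.single i 1 by
    rw [← Pi.single_smul]; simp, map_smul, smul_eq_mul, mul_comm]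

lemma fderiv_of_grad {d : ℕ} {f g : (Fin d → ℝ) → ℝ} {x : Fin d → ℝ}
    {A : Matrix (Fin d) (Fin d) ℝ} (h : grad f x = A.mulVec (grad g x)) (v : Fin d → ℝ) :
    fderiv ℝ f x v = fderiv ℝ g x (A.transpose.mulVec v) := by
  rw [fderiv_eq_grad, fderiv_eq_grad, h, Matrix.dotProduct_mulVec, Matrix.vecMul_transpose]

lemma grad_of_fderiv {d : ℕ} {f g : (Fin d → ℝ) → ℝ} {x : Fin d → ℝ}
    {A : Matrix (Fin d) (Fin d) ℝ}
    (h : ∀ v, fderiv ℝ f x v = fderiv ℝ g x (A.transpose.mulVec v)) :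
    grad f x = A.mulVec (grad g x) := by
  ext i
  have := h (Pi.single i 1)
  rw [fderiv_eq_grad, fderiv_eq_grad, Matrix.dotProduct_mulVec, Matrix.vecMul_transpose] at this
  simpa using this

/-- transposed matrix as a continuous linear map -/
noncomputable def tcl {d : ℕ} (A : Matrix (Fin d) (Fin d) ℝ) : (Fin d → ℝ) →L[ℝ] (Fin d → ℝ) :=
  LinearMap.toContinuousLinearMap (A.transpose.mulVecLin)

lemma tcl_apply {d : ℕ} (A : Matrix (Fin d) (Fin d) ℝ) (v : Fin d → ℝ) :
    tcl A v = A.transpose.mulVec v := rfl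

lemma fderiv_comp_tcl {d : ℕ} {Ω : Set (Fin d → ℝ)} (hΩ : IsOpen Ω) {g : (Fin d → ℝ) → ℝ}
    (hg : ContDiffOn ℝ (⊤ : ℕ∞) g Ω) (A : Matrix (Fin d) (Fin d) ℝ) {x : Fin d → ℝ} (hx : x ∈ Ω) :
    HasFDerivAt (fun y => (fderiv ℝ g y).comp (tcl A))
      (((ContinuousLinearMap.compL ℝ _ _ ℝ).flip (tcl A)).comp (fderiv ℝ (fderiv ℝ g) x)) x := by
  have h1 := ((contDiffOn_infty_iff_fderiv_of_isOpen hΩ).1 hg).2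
  have h2 : DifferentiableAt ℝ (fderiv ℝ g) x :=
    (h1.differentiableOn (by simp)).differentiableAt (hΩ.mem_nhds hx)
  exact (((ContinuousLinearMap.compL ℝ _ _ ℝ).flip (tcl A)).hasFDerivAt).comp x h2.hasFDerivAt

lemma hess_symm {d : ℕ} {Ω : Set (Fin d → ℝ)} (hΩ : IsOpen Ω) {g : (Fin d → ℝ) → ℝ}
    (hg : ContDiffOn ℝ (⊤ : ℕ∞) g Ω) {x : Fin d → ℝ} (hx : x ∈ Ω) (u v : Fin d → ℝ) :
    fderiv ℝ (fderiv ℝ g) x u v = fderiv ℝ (fderiv ℝ g) x v u := by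
  refine (hg.contDiffAt (hΩ.mem_nhds hx)).isSymmSndFDerivAt ?_ u v
  simp only [minSmoothness_of_isRCLikeNormedField]
  exact WithTop.coe_le_coe.2 (le_top : (2 : ℕ∞) ≤ ⊤)

/-- symmetry predicate -/
def HSym {d : ℕ} (Ω : Set (Fin d → ℝ)) (g : (Fin d → ℝ) → ℝ) (A : Matrix (Fin d) (Fin d) ℝ) :
    Prop :=
  ∀ x ∈ Ω, ∀ u v, fderiv ℝ (fderiv ℝ g) x u (tcl A v) = fderiv ℝ (fderiv ℝ g) x v (tcl A u)

lemma HSym.mul {d : ℕ} {Ω : Set (Fin d → ℝ)} (hΩ : IsOpen Ω) {g : (Fin d → ℝ) → ℝ}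
    (hg : ContDiffOn ℝ (⊤ : ℕ∞) g Ω) {A B : Matrix (Fin d) (Fin d) ℝ} (hA : HSym Ω g A)
    (hB : HSym Ω g B) (hAB : Commute A B) : HSym Ω g (A * B) := by
  intro x hx u v
  have h1 : tcl (A * B) v = tcl B (tcl A v) := by
    simp [tcl_apply, Matrix.transpose_mul, Matrix.mulVec_mulVec]
  have h2 : tcl (A * B) u = tcl A (tcl B u) := by
    rw [hAB.eq]; simp [tcl_apply, Matrix.transpose_mul, Matrix.mulVec_mulVec]
  rw [h1, h2, hB x hx, hess_symm hΩ hg hx, hA x hx]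

lemma HSym.sub {d : ℕ} {Ω : Set (Fin d → ℝ)} (hΩ : IsOpen Ω) {g : (Fin d → ℝ) → ℝ}
    (hg : ContDiffOn ℝ (⊤ : ℕ∞) g Ω) {A : Matrix (Fin d) (Fin d) ℝ} (hA : HSym Ω g A)
    (c : ℝ) : HSym Ω g (c • 1 - A) := by
  intro x hx u v
  have h1 : ∀ v, tcl (c • 1 - A) v = c • v - tcl A v := by
    intro v
    simp [tcl_apply, Matrix.sub_mulVec, Matrix.smul_mulVec]
  rw [h1, h1, map_sub, map_sub, map_smul, map_smul, hA x hx, hess_symm hΩ hg hx]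

lemma HSym.exists_pot {d : ℕ} {Ω : Set (Fin d → ℝ)} (hΩ : IsOpen Ω) (hc : Convex ℝ Ω)
    {g : (Fin d → ℝ) → ℝ}
    (hg : ContDiffOn ℝ (⊤ : ℕ∞) g Ω) {A : Matrix (Fin d) (Fin d) ℝ} (hA : HSym Ω g A) :
    ∃ U : (Fin d → ℝ) → ℝ, ContDiffOn ℝ (⊤ : ℕ∞) U Ω ∧
      ∀ x ∈ Ω, grad U x = A.mulVec (grad g x) := by
  obtain ⟨U, hU⟩ := hc.exists_forall_hasFDerivAt_of_fderiv_symmetric hΩ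
    (ω := fun y => (fderiv ℝ g y).comp (tcl A))
    (fun x hx => (fderiv_comp_tcl hΩ hg A hx).differentiableAt.differentiableWithinAt) (by
      intro x hx u v
      rw [(fderiv_comp_tcl hΩ hg A hx).fderiv]
      exact hA x hx u v)
  refine ⟨U, ?_, fun x hx => grad_of_fderiv fun v => ?_⟩
  · refine (contDiffOn_infty_iff_fderiv_of_isOpen hΩ).2
      ⟨fun x hx => (hU x hx).differentiableAt.differentiableWithinAt, ?_⟩
    have h1 := ((contDiffOn_infty_iff_fderiv_of_isOpen hΩ).1 hg).2
    exact (h1.clm_comp (contDiffOn_const (c := tcl A))).congr fun x hx => (hU x hx).fderiv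
  · rw [(hU x hx).fderiv]; rfl

lemma HSym.of_grad {d : ℕ} {Ω : Set (Fin d → ℝ)} (hΩ : IsOpen Ω)
    {f g : (Fin d → ℝ) → ℝ} (hf : ContDiffOn ℝ (⊤ : ℕ∞) f Ω)
    (hg : ContDiffOn ℝ (⊤ : ℕ∞) g Ω) {A : Matrix (Fin d) (Fin d) ℝ}
    (h : ∀ x ∈ Ω, grad f x = A.mulVec (grad g x)) : HSym Ω g A := by
  intro x hx u v
  have h1 : fderiv ℝ f =ᶠ[nhds x] fun y => (fderiv ℝ g y).comp (tcl A) := by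
    filter_upwards [hΩ.mem_nhds hx] with y hy
    ext1 w
    exact fderiv_of_grad (h y hy) w
  have h2 := h1.fderiv_eq (𝕜 := ℝ)
  rw [(fderiv_comp_tcl hΩ hg A hx).fderiv] at h2
  have h3 := hess_symm hΩ hf hx u v
  rw [h2] at h3
  exact h3

lemma seqA_last {d n : ℕ} (M : Matrix (Fin d) (Fin d) ℝ) (hM : IsUnit M)
    (hn : (1 + M ^ 2) ^ (n + 1) = 0) :
    seqA M (fun j => ((1 + X ^ 2 : Polynomial ℝ) ^ (n + 1)).coeff j) (2 * n + 1) = 1 := by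
  have hdet : IsUnit M.det := (Matrix.isUnit_iff_isUnit_det M).1 hM
  have hNM : M⁻¹ * M = 1 := Matrix.nonsing_inv_mul M hdet
  have hMN : M * M⁻¹ = 1 := Matrix.mul_nonsing_inv M hdet
  have hmonic : ((X ^ 2 + 1 : Polynomial ℝ)).Monic := by monicity!
  have hdeg2 : (X ^ 2 + 1 : Polynomial ℝ).natDegree = 2 := by compute_degree!
  rw [add_comm (1 : Polynomial ℝ)]
  set p : Polynomial ℝ := (X ^ 2 + 1) ^ (n + 1) with hp
  have hpm : p.Monic := hmonic.pow _
  have hdeg : p.natDegree = 2 * n + 2 := by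
    rw [hp, hmonic.natDegree_pow, hdeg2]; ring
  have hZ0 : p.coeff 0 = 1 := by
    rw [coeff_zero_eq_eval_zero, hp]; simp
  have key : ∀ j, (-M⁻¹) ^ (j + 1) * seqA M (fun j => p.coeff j) j =
      - ∑ i ∈ Finset.range (j + 1), p.coeff i • (-M⁻¹) ^ i := by
    intro j
    induction j with
    | zero => simp [seqA, hNM, hZ0]
    | succ j ih =>
      rw [Finset.sum_range_succ, neg_add, ← ih, seqA, pow_succ (-M⁻¹) (j + 1), mul_assoc,
        ← mul_assoc (-M⁻¹) M, neg_mul M⁻¹ M, hNM, neg_one_mul, neg_sub, mul_sub]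
      simp [sub_eq_add_neg]
  have hk := key (2 * n + 1)
  have hev : aeval (-M⁻¹) p = 0 := by
    have h1 : (M⁻¹) ^ 2 + 1 = (M⁻¹) ^ 2 * (1 + M ^ 2) := by
      rw [mul_add, mul_one]
      congr 1
      rw [pow_two, pow_two, mul_assoc, ← mul_assoc M⁻¹ M, hNM, one_mul, hNM]
    have hcM : Commute M⁻¹ M := by rw [Commute, SemiconjBy, hNM, hMN]
    have hc : Commute ((M⁻¹) ^ 2) (1 + M ^ 2) :=
      (Commute.one_right _).add_right (hcM.pow_pow 2 2)
    rw [hp]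
    simp only [map_pow, map_add, aeval_X, map_one]
    rw [neg_sq, h1, hc.mul_pow, hn, mul_zero]
  rw [aeval_eq_sum_range, hdeg, Finset.sum_range_succ] at hev
  have hlead : p.coeff (2 * n + 2) = 1 := by rw [← hdeg]; exact hpm
  rw [hlead, one_smul] at hev
  rw [show 2 * n + 1 + 1 = 2 * n + 2 from rfl, ← eq_neg_of_add_eq_zero_right hev] at hk
  have hu : IsUnit ((-M⁻¹) ^ (2 * n + 2)) := by
    apply IsUnit.pow
    apply IsUnit.neg
    exact (Matrix.isUnit_nonsing_inv_iff).2 hM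
  exact hu.mul_left_cancel (by rw [hk, mul_one])

lemma isUnit_of_nilp {d n : ℕ} (M : Matrix (Fin d) (Fin d) ℝ)
    (hn : (1 + M ^ 2) ^ (n + 1) = 0) : IsUnit M := by
  have h : IsUnit (M ^ 2) := by
    have h1 : IsNilpotent (1 + M ^ 2) := ⟨n + 1, hn⟩
    have h2 := h1.isUnit_sub_one
    rwa [add_sub_cancel_left] at h2
  exact (isUnit_pow_iff two_ne_zero).1 h

/-- For `M` a block diagonal of real Jordan blocks with eigenvalues `±i`, total size
`2(n+1)`, and `Z_j` the coefficients of `(1+μ²)^{n+1}`: `M` is invertible, and any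
smooth solution of `∇f = M∇g` on a nonempty open convex `Ω` extends to smooth
`V_0 = f, V_1, …, V_{2n}, V_{2n+1} = g` with
`M⁻¹∇V_j + ∇V_{j−1} = Z_j∇g` (`V_{−1} := 0`) for `0 ≤ j ≤ 2n+1`; the middle
functions `V_1, …, V_{2n}` are unique up to additive constants. -/
theorem stmt_2 (n : ℕ) (ε : ℕ → Bool) (M : Matrix (Fin (2 * (n + 1))) (Fin (2 * (n + 1))) ℝ)
    (hM : M = realJordanDiag n ε) :
    IsUnit M ∧
    ∀ (Ω : Set (Fin (2 * (n + 1)) → ℝ)), IsOpen Ω → Convex ℝ Ω → Ω.Nonempty →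
    ∀ f g : (Fin (2 * (n + 1)) → ℝ) → ℝ,
      ContDiffOn ℝ (⊤ : ℕ∞) f Ω → ContDiffOn ℝ (⊤ : ℕ∞) g Ω →
      (∀ x ∈ Ω, grad f x = M.mulVec (grad g x)) →
      (∃ V : ℕ → ((Fin (2 * (n + 1)) → ℝ) → ℝ),
        V 0 = f ∧ V (2 * n + 1) = g ∧
        (∀ j ≤ 2 * n + 1, ContDiffOn ℝ (⊤ : ℕ∞) (V j) Ω) ∧
        (∀ j ≤ 2 * n + 1, ∀ x ∈ Ω,
          M⁻¹.mulVec (grad (V j) x) + (if j = 0 then 0 else grad (V (j - 1)) x)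
            = (((1 + X ^ 2 : Polynomial ℝ) ^ (n + 1)).coeff j) • grad g x)) ∧
      (∀ V W : ℕ → ((Fin (2 * (n + 1)) → ℝ) → ℝ),
        V 0 = f → V (2 * n + 1) = g → W 0 = f → W (2 * n + 1) = g →
        (∀ j ≤ 2 * n + 1, ContDiffOn ℝ (⊤ : ℕ∞) (V j) Ω) →
        (∀ j ≤ 2 * n + 1, ContDiffOn ℝ (⊤ : ℕ∞) (W j) Ω) →
        (∀ j ≤ 2 * n + 1, ∀ x ∈ Ω,
          M⁻¹.mulVec (grad (V j) x) + (if j = 0 then 0 else grad (V (j - 1)) x)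
            = (((1 + X ^ 2 : Polynomial ℝ) ^ (n + 1)).coeff j) • grad g x) →
        (∀ j ≤ 2 * n + 1, ∀ x ∈ Ω,
          M⁻¹.mulVec (grad (W j) x) + (if j = 0 then 0 else grad (W (j - 1)) x)
            = (((1 + X ^ 2 : Polynomial ℝ) ^ (n + 1)).coeff j) • grad g x) →
        ∀ j, 1 ≤ j → j ≤ 2 * n → ∃ c : ℝ, ∀ x ∈ Ω, V j x = W j x + c) := by
  subst hM
  have hnil := jord_nilp n ε
  set M := realJordanDiag n ε with hMdef
  have hu : IsUnit M := isUnit_of_nilp M hnil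
  have hdet : IsUnit M.det := (Matrix.isUnit_iff_isUnit_det M).1 hu
  have hNM : M⁻¹ * M = 1 := Matrix.nonsing_inv_mul M hdet
  have hMN : M * M⁻¹ = 1 := Matrix.mul_nonsing_inv M hdet
  have hlast := seqA_last M hu hnil
  have hZ0 : ((1 + X ^ 2 : Polynomial ℝ) ^ (n + 1)).coeff 0 = 1 := by
    rw [coeff_zero_eq_eval_zero]; simp
  refine ⟨hu, fun Ω hΩ hc hne f g hf hg hfg => ⟨?_, ?_⟩⟩
  · set Z : ℕ → ℝ := fun j => ((1 + X ^ 2 : Polynomial ℝ) ^ (n + 1)).coeff j with hZ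
    have hMs : HSym Ω g M := HSym.of_grad hΩ hf hg hfg
    have hs : ∀ j, HSym Ω g (seqA M Z j) := by
      intro j
      induction j with
      | zero => exact hMs
      | succ j ih =>
        exact HSym.mul hΩ hg hMs (HSym.sub hΩ hg ih _)
          (((Commute.one_right M).smul_right _).sub_right (seqA_comm M Z j))
    choose U hU1 hU2 using fun j => HSym.exists_pot hΩ hc hg (hs j)
    let V : ℕ → ((Fin (2 * (n + 1)) → ℝ) → ℝ) := fun j =>
      if j = 0 then f else if j = 2 * n + 1 then g else U j
    have hV0 : V 0 = f := by simp [V]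
    have hVl : V (2 * n + 1) = g := by simp [V]
    have hVg : ∀ j, ∀ x ∈ Ω, grad (V j) x = (seqA M Z j).mulVec (grad g x) := by
      intro j x hx
      by_cases h0 : j = 0
      · subst h0; rw [hV0]; exact hfg x hx
      by_cases h1 : j = 2 * n + 1
      · subst h1; rw [hVl, hlast, Matrix.one_mulVec]
      · have : V j = U j := by simp [V, h0, h1]
        rw [this]; exact hU2 j x hx
    refine ⟨V, hV0, hVl, fun j _ => ?_, fun j _ x hx => ?_⟩
    · by_cases h0 : j = 0
      · subst h0; rw [hV0]; exact hf
      by_cases h1 : j = 2 * n + 1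
      · subst h1; rw [hVl]; exact hg
      · have : V j = U j := by simp [V, h0, h1]
        rw [this]; exact hU1 j
    · rw [hVg j x hx, Matrix.mulVec_mulVec]
      cases j with
      | zero => simp [seqA, hNM, hZ0]
      | succ j =>
        rw [if_neg (Nat.succ_ne_zero j), Nat.add_sub_cancel, hVg j x hx, seqA, ← mul_assoc, hNM,
          one_mul, Matrix.sub_mulVec, Matrix.smul_mulVec, Matrix.one_mulVec, sub_add_cancel]
  · intro V W hV0 hVl hW0 hWl hVs hWs hV hW
    have hinj : Function.Injective (M⁻¹).mulVec := by
      intro a b hab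
      have := congrArg M.mulVec hab
      simpa [Matrix.mulVec_mulVec, hMN] using this
    have hgr : ∀ j ≤ 2 * n + 1, ∀ x ∈ Ω, grad (V j) x = grad (W j) x := by
      intro j
      induction j with
      | zero => intro _ x _; rw [hV0, hW0]
      | succ j ih =>
        intro hj x hx
        have h1 := hV (j + 1) hj x hx
        have h2 := hW (j + 1) hj x hx
        rw [← h2, if_neg (Nat.succ_ne_zero j), if_neg (Nat.succ_ne_zero j), Nat.add_sub_cancel,
          ih (by omega) x hx] at h1
        exact hinj (add_right_cancel h1)
    intro j _ hj
    obtain ⟨c, hcc⟩ := hΩ.exists_eq_add_of_fderiv_eq hc.isPreconnected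
      ((hVs j (by omega)).differentiableOn (by simp))
      ((hWs j (by omega)).differentiableOn (by simp)) (fun x hx => by
        ext1 v
        rw [fderiv_eq_grad, fderiv_eq_grad, hgr j (by omega) x hx])
    exact ⟨c, fun x hx => hcc hx⟩
end

section
/- Let R be a commutative ring, n ∈ ℕ, and let a_0, …, a_n, s_0, …, s_{2n+1} ∈ R. Set a(μ) = Σ_{i=0}^n a_i·(1+μ²)^i and s(μ) = Σ_{r=0}^{2n+1} s_r·μ^r in R[μ]. Then the coefficient of μ^{2n+1} in the remainder of a(μ)·s(μ) on division by the monic polynomial (1+μ²)^{n+1} equals Σ_{r=0}^n s_{2r+1}·( Σ_{i=0}^r (−1)^{r−i}·C(r,i)·a_{n−i} ). -/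
open Polynomial

lemma aux_monic (R : Type*) [CommRing R] (j : ℕ) : ((1 + X ^ 2 : R[X]) ^ j).Monic := by
  have h : (1 + X ^ 2 : R[X]).Monic := by
    rw [add_comm]
    exact monic_X_pow_add_C (1 : R) two_ne_zero
  exact h.pow j

lemma aux_deg (R : Type*) [CommRing R] [Nontrivial R] (j : ℕ) :
    ((1 + X ^ 2 : R[X]) ^ j).natDegree = 2 * j := by
  have h : (1 + X ^ 2 : R[X]).Monic := by simpa using aux_monic R 1
  have h2 : (1 + X ^ 2 : R[X]).natDegree = 2 := by
    rw [add_comm]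
    exact natDegree_X_pow_add_C (r := (1 : R))
  rw [h.natDegree_pow, h2, mul_comm]

noncomputable def auxL (R : Type*) [CommRing R] (n : ℕ) : R[X] →ₗ[R] R :=
  (lcoeff R (2 * n + 1)).comp (modByMonicHom ((1 + X ^ 2 : R[X]) ^ (n + 1)))

lemma auxL_apply (R : Type*) [CommRing R] (n : ℕ) (p : R[X]) :
    auxL R n p = (p %ₘ ((1 + X ^ 2) ^ (n + 1))).coeff (2 * n + 1) := rfl

lemma auxL_pow (R : Type*) [CommRing R] [Nontrivial R] (n j e : ℕ) (he : e ≤ 1) :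
    auxL R n ((1 + X ^ 2) ^ j * X ^ e) = if j = n ∧ e = 1 then 1 else 0 := by
  rw [auxL_apply]
  rcases Nat.lt_or_ge n j with h | h
  · have : ((1 + X ^ 2 : R[X]) ^ j * X ^ e) %ₘ ((1 + X ^ 2) ^ (n + 1)) = 0 := by
      rw [modByMonic_eq_zero_iff_dvd (aux_monic R _)]
      exact Dvd.dvd.mul_right (pow_dvd_pow _ h) _
    rw [this, if_neg (by omega), coeff_zero]
  · have hd : ((1 + X ^ 2 : R[X]) ^ j * X ^ e).natDegree = 2 * j + e := by
      rw [(aux_monic R j).natDegree_mul (monic_X_pow e), aux_deg, natDegree_X_pow]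
    have hm : ((1 + X ^ 2 : R[X]) ^ j * X ^ e).Monic := (aux_monic R j).mul (monic_X_pow e)
    rw [(modByMonic_eq_self_iff (aux_monic R _)).2]
    · split_ifs with hc
      · have h3 := hm.coeff_natDegree
        rw [hd] at h3
        obtain ⟨rfl, rfl⟩ := hc
        exact h3
      · apply coeff_eq_zero_of_natDegree_lt
        rw [hd]
        omega
    · apply degree_lt_degree
      rw [hd, aux_deg]
      omega

lemma aux_expand (R : Type*) [CommRing R] (r e : ℕ) :
    (X ^ (2 * r + e) : R[X]) = ∑ i ∈ Finset.range (r + 1),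
      C ((-1 : R) ^ (r - i) * (r.choose i : R)) * ((1 + X ^ 2) ^ i * X ^ e) := by
  have h : (X ^ 2 : R[X]) = (1 + X ^ 2) + (-1) := by ring
  rw [pow_add, pow_mul]
  conv_lhs => rw [h]
  rw [add_pow, Finset.sum_mul]
  refine Finset.sum_congr rfl fun i _ => ?_
  simp only [map_mul, map_pow, map_neg, map_one, map_natCast]
  ring

lemma auxL_X (R : Type*) [CommRing R] [Nontrivial R] (n : ℕ) (a : ℕ → R) (r e : ℕ)
    (he : e ≤ 1) (hr : r ≤ n) :
    auxL R n ((∑ i ∈ Finset.range (n + 1), C (a i) * (1 + X ^ 2) ^ i) * X ^ (2 * r + e)) =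
      if e = 1 then
        ∑ i ∈ Finset.range (r + 1), (-1 : R) ^ (r - i) * (r.choose i : R) * a (n - i)
      else 0 := by
  have key : ∀ i ∈ Finset.range (r + 1),
      auxL R n ((∑ k ∈ Finset.range (n + 1), C (a k) * (1 + X ^ 2) ^ k) *
        (C ((-1 : R) ^ (r - i) * (r.choose i : R)) * ((1 + X ^ 2) ^ i * X ^ e))) =
      if e = 1 then (-1 : R) ^ (r - i) * (r.choose i : R) * a (n - i) else 0 := by
    intro i hi
    have hi' : i ≤ r := by simpa [Nat.lt_succ_iff] using hi
    generalize (-1 : R) ^ (r - i) * (r.choose i : R) = c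
    rw [Finset.sum_mul, map_sum, Finset.sum_eq_single (n - i)]
    · have : C (a (n - i)) * (1 + X ^ 2) ^ (n - i) * (C c * ((1 + X ^ 2) ^ i * X ^ e))
          = (c * a (n - i)) • ((1 + X ^ 2) ^ n * X ^ e) := by
        have hn : n = (n - i) + i := by omega
        rw [smul_eq_C_mul, map_mul]
        conv_rhs => rw [show ((1 + X ^ 2 : R[X]) ^ n) = (1 + X ^ 2) ^ ((n - i) + i) by rw [← hn]]
        rw [pow_add]
        ring
      rw [this, map_smul, auxL_pow R n n e he]
      simp
    · intro k _ hk'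
      have : C (a k) * (1 + X ^ 2) ^ k * (C c * ((1 + X ^ 2) ^ i * X ^ e))
          = (c * a k) • ((1 + X ^ 2) ^ (k + i) * X ^ e) := by
        rw [smul_eq_C_mul, map_mul, pow_add]
        ring
      rw [this, map_smul, auxL_pow R n _ e he, if_neg (by omega), smul_zero]
    · intro h
      exact absurd (Finset.mem_range.2 (by omega)) h
  rw [aux_expand, Finset.mul_sum, map_sum, Finset.sum_congr rfl key]
  split_ifs <;> simp

lemma aux_split {M : Type*} [AddCommMonoid M] (f : ℕ → M) (m : ℕ) :
    ∑ r ∈ Finset.range (2 * m), f r =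
      ∑ r ∈ Finset.range m, (f (2 * r + 0) + f (2 * r + 1)) := by
  induction m with
  | zero => simp
  | succ k ih =>
    rw [Finset.sum_range_succ, ← ih, show 2 * (k + 1) = 2 * k + 1 + 1 by ring,
      Finset.sum_range_succ, Finset.sum_range_succ, add_assoc, add_zero]

/-- The coefficient of `μ^{2n+1}` in the remainder of
`(Σ_{i=0}^n a_i (1+μ²)^i)·(Σ_{r=0}^{2n+1} s_r μ^r)` modulo `(1+μ²)^{n+1}` equals
`Σ_{r=0}^n s_{2r+1}·(Σ_{i=0}^r (−1)^{r−i}·C(r,i)·a_{n−i})`. -/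
theorem stmt_14 (R : Type*) [CommRing R] (n : ℕ) (a s : ℕ → R) :
    (((∑ i ∈ Finset.range (n + 1), C (a i) * (1 + X ^ 2) ^ i) *
          (∑ r ∈ Finset.range (2 * n + 2), C (s r) * X ^ r)) %ₘ
        ((1 + X ^ 2) ^ (n + 1))).coeff (2 * n + 1) =
      ∑ r ∈ Finset.range (n + 1),
        s (2 * r + 1) *
          (∑ i ∈ Finset.range (r + 1), (-1 : R) ^ (r - i) * (r.choose i : R) * a (n - i)) := by
  rcases subsingleton_or_nontrivial R with _ | _
  · exact Subsingleton.elim _ _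
  rw [← auxL_apply, show 2 * n + 2 = 2 * (n + 1) by ring, Finset.mul_sum, map_sum, aux_split]
  refine Finset.sum_congr rfl fun r hr => ?_
  have hr' : r ≤ n := by simpa [Nat.lt_succ_iff] using hr
  have hs : ∀ (p q : R[X]) (c : R), auxL R n (p * (C c * q)) = c * auxL R n (p * q) := by
    intro p q c
    rw [mul_left_comm, ← smul_eq_C_mul, map_smul, smul_eq_mul]
  rw [hs, hs, auxL_X R n a r 0 (by omega) hr', auxL_X R n a r 1 le_rfl hr']
  simp
end
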